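/- The Newton polygon at the prime 3 of the polynomial g̃(X) = X⁸ + 38X⁷ + 783X⁶ + (9795/2)X⁵ − (42189/2)X⁴ − (1312335/2)X³ + (74121075/16)X² − (23674275/2)X + 12301875 consists of three line segments of horizontal lengths 4, 3 and 1 with slopes −2, −1/3 and 0 respectively; consequently the decomposition group at 3 of the splitting field of g̃ over Q, viewed as a permutation group on the 8 roots, has at least one fixed point and at least one orbit of length 3. -/

import Mathlib

open Polynomial

/-- The degree-8 polynomial `g̃` over `ℚ`. -/
noncomputable def gTilde : ℚ[X] :=
  X ^ 8 + C (38 : ℚ) * X ^ 7 + C (783 : ℚ) * X ^ 6 + C (9795 / 2 : ℚ) * X ^ 5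
    - C (42189 / 2 : ℚ) * X ^ 4 - C (1312335 / 2 : ℚ) * X ^ 3
    + C (74121075 / 16 : ℚ) * X ^ 2 - C (23674275 / 2 : ℚ) * X + C (12301875 : ℚ)

/-- The piecewise linear function whose graph consists of the segment from `(0,9)` to
`(4,1)` (slope `−2`, length `4`), the segment from `(4,1)` to `(7,0)` (slope `−1/3`,
length `3`), and the segment from `(7,0)` to `(8,0)` (slope `0`, length `1`). -/
noncomputable def lowerNP (x : ℚ) : ℚ :=
  if x ≤ 4 then 9 - 2 * x else if x ≤ 7 then 1 - (x - 4) / 3 else 0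

/-- The `3`-adic valuation of the `j`-th coefficient of `g̃`, as a rational number. -/
noncomputable def npPoint (j : ℕ) : ℚ := (padicValRat 3 (gTilde.coeff j) : ℚ)

/-- The polynomial `g̃` mapped to `ℚ₃`; the decomposition group at `3` of the splitting
field of `g̃` over `ℚ` is the Galois group of `g̃` over `ℚ₃`. -/
noncomputable def gTilde3 : Polynomial ℚ_[3] := gTilde.map (algebraMap ℚ ℚ_[3])

lemma val3 (q : ℚ) (k : ℕ) (a b : ℤ) (ha : ¬ (3 : ℤ) ∣ a) (hb : ¬ (3 : ℤ) ∣ b)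
    (h : q * b = 3 ^ k * a) : q ≠ 0 ∧ padicValRat 3 q = k := by
  have ha0 : (a : ℚ) ≠ 0 := by
    intro h0
    apply ha
    have : a = 0 := by exact_mod_cast h0
    simp [this]
  have hb0 : (b : ℚ) ≠ 0 := by
    intro h0
    apply hb
    have : b = 0 := by exact_mod_cast h0
    simp [this]
  have h3 : ((3 : ℚ) ^ k) ≠ 0 := by positivity
  have hq : q ≠ 0 := by
    rintro rfl
    rw [zero_mul] at h
    exact mul_ne_zero h3 ha0 h.symm
  refine ⟨hq, ?_⟩
  have : Fact (Nat.Prime 3) := ⟨Nat.prime_three⟩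
  have h1 := congrArg (padicValRat 3) h
  rw [padicValRat.mul hq hb0, padicValRat.mul h3 ha0, padicValRat.pow] at h1
  have e3 : padicValRat 3 (3 : ℚ) = 1 := by
    have := padicValRat.self (p := 3) (by norm_num)
    exact_mod_cast this
  rw [e3, padicValRat.of_int, padicValRat.of_int,
    padicValInt.eq_zero_of_not_dvd (by exact_mod_cast hb),
    padicValInt.eq_zero_of_not_dvd (by exact_mod_cast ha)] at h1
  simpa using h1

/-- valuations of the coefficients -/
def vv : ℕ → ℕ
  | 0 => 9
  | 1 => 7
  | 2 => 6
  | 3 => 3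
  | 4 => 1
  | 5 => 1
  | 6 => 3
  | _ => 0

lemma coeff_vals (j : ℕ) (hj : j ≤ 8) :
    gTilde.coeff j ≠ 0 ∧ padicValRat 3 (gTilde.coeff j) = vv j := by
  interval_cases j
  · exact val3 _ _ 625 1 (by norm_num) (by norm_num)
      (by norm_num [gTilde, vv, coeff_X, coeff_C, coeff_X_pow])
  · exact val3 _ _ (-10825) 2 (by norm_num) (by norm_num)
      (by norm_num [gTilde, vv, coeff_X, coeff_C, coeff_X_pow])
  · exact val3 _ _ 101675 16 (by norm_num) (by norm_num)
      (by norm_num [gTilde, vv, coeff_X, coeff_C, coeff_X_pow])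
  · exact val3 _ _ (-48605) 2 (by norm_num) (by norm_num)
      (by norm_num [gTilde, vv, coeff_X, coeff_C, coeff_X_pow])
  · exact val3 _ _ (-14063) 2 (by norm_num) (by norm_num)
      (by norm_num [gTilde, vv, coeff_X, coeff_C, coeff_X_pow])
  · exact val3 _ _ 3265 2 (by norm_num) (by norm_num)
      (by norm_num [gTilde, vv, coeff_X, coeff_C, coeff_X_pow])
  · exact val3 _ _ 29 1 (by norm_num) (by norm_num)
      (by norm_num [gTilde, vv, coeff_X, coeff_C, coeff_X_pow])
  · exact val3 _ _ 38 1 (by norm_num) (by norm_num)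
      (by norm_num [gTilde, vv, coeff_X, coeff_C, coeff_X_pow])
  · exact val3 _ _ 1 1 (by norm_num) (by norm_num)
      (by norm_num [gTilde, vv, coeff_X, coeff_C, coeff_X_pow])

lemma np_part : ((∀ j ≤ 8, gTilde.coeff j ≠ 0 ∧ lowerNP j ≤ npPoint j) ∧
      npPoint 0 = 9 ∧ npPoint 4 = 1 ∧ npPoint 7 = 0 ∧ npPoint 8 = 0) := by
  refine ⟨fun j hj => ⟨(coeff_vals j hj).1, ?_⟩, ?_, ?_, ?_, ?_⟩
  · rw [npPoint, (coeff_vals j hj).2]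
    interval_cases j <;> norm_num [lowerNP, vv]
  all_goals
    rw [npPoint, (coeff_vals _ (by norm_num)).2]
    norm_num [vv]

lemma gT_natDegree : gTilde.natDegree = 8 := by
  unfold gTilde
  compute_degree!

lemma gT_monic : gTilde.Monic := by
  rw [Monic, leadingCoeff, gT_natDegree]
  norm_num [gTilde, coeff_X, coeff_C, coeff_X_pow]

lemma g3_monic : gTilde3.Monic := gT_monic.map _

lemma g3_natDegree : gTilde3.natDegree = 8 := by
  rw [gTilde3, gT_monic.natDegree_map, gT_natDegree]

lemma g3_coeff (j : ℕ) (hj : j ≤ 8) : ‖gTilde3.coeff j‖ = ((1 : ℝ) / 3) ^ vv j := by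
  obtain ⟨h1, h2⟩ := coeff_vals j hj
  rw [gTilde3, coeff_map, eq_ratCast, Padic.eq_padicNorm, padicNorm.eq_zpow_of_nonzero h1, h2]
  simp

lemma sum_lt {L : Type*} [Field L] (N : L → ℝ) (h0 : N 0 = 0)
    (hadd : ∀ x y, N (x + y) ≤ max (N x) (N y)) {ι : Type*} (s : Finset ι) (t : ι → L) (B : ℝ)
    (hB : 0 < B) (h : ∀ j ∈ s, N (t j) < B) : N (∑ j ∈ s, t j) < B := by
  classical
  induction s using Finset.induction_on with
  | empty => simpa [h0] using hB
  | insert a s ha ih =>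
    rw [Finset.sum_insert ha]
    refine lt_of_le_of_lt (hadd _ _) (max_lt (h a (by simp)) (ih fun j hj => h j (by simp [hj])))

lemma dom {L : Type*} [Field L] (N : L → ℝ) (h0 : N 0 = 0) (hneg : ∀ x, N (-x) = N x)
    (hadd : ∀ x y, N (x + y) ≤ max (N x) (N y)) {ι : Type*} [DecidableEq ι]
    (s : Finset ι) (t : ι → L)
    (i : ι) (hi : i ∈ s) (hpos : 0 < N (t i)) (h : ∀ j ∈ s, j ≠ i → N (t j) < N (t i))
    (hs : ∑ j ∈ s, t j = 0) : False := by
  rw [← Finset.add_sum_erase s t hi, add_comm, add_eq_zero_iff_eq_neg] at hs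
  have := sum_lt N h0 hadd (s.erase i) t _ hpos
    (fun j hj => h j (Finset.mem_of_mem_erase hj) (Finset.ne_of_mem_erase hj))
  rw [hs, hneg] at this
  exact lt_irrefl _ this

lemma root_norm {L : Type*} [Field L] [Algebra ℚ_[3] L] (N : L → ℝ) (h0 : N 0 = 0)
    (hnn : ∀ x, 0 ≤ N x) (hneg : ∀ x, N (-x) = N x) (hmul : ∀ x y, N (x * y) = N x * N y)
    (hpow : ∀ x (n : ℕ), N (x ^ n) = N x ^ n)
    (hext : ∀ x : ℚ_[3], N (algebraMap ℚ_[3] L x) = ‖x‖)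
    (hadd : ∀ x y, N (x + y) ≤ max (N x) (N y)) (r : L) (hr : aeval r gTilde3 = 0) :
    N r = 1 / 9 ∨ N r ^ 3 = 1 / 3 ∨ N r = 1 := by
  rw [aeval_eq_sum_range, g3_natDegree] at hr
  have hN : ∀ j ∈ Finset.range 9, N (gTilde3.coeff j • r ^ j) = (1 / 3) ^ vv j * N r ^ j := by
    intro j hj
    rw [Algebra.smul_def, hmul, hext, hpow, g3_coeff j (by simp at hj; omega)]
  have key : ∀ i ∈ Finset.range 9, 0 < ((1 : ℝ) / 3) ^ vv i * N r ^ i →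
      (∀ j ∈ Finset.range 9, j ≠ i →
        ((1 : ℝ) / 3) ^ vv j * N r ^ j < (1 / 3) ^ vv i * N r ^ i) → False := by
    intro i hi hp h
    refine dom N h0 hneg hadd (Finset.range 9) _ i hi ?_ ?_ hr
    · rw [hN i hi]; exact hp
    · intro j hj hji
      rw [hN i hi, hN j hj]
      exact h j hj hji
  have hx := hnn r
  generalize N r = x at *
  clear hN hr
  by_contra hcon
  push Not at hcon
  obtain ⟨c1, c2, c3⟩ := hcon
  rcases lt_or_gt_of_ne c1 with h | h
  · refine key 0 (by simp) (by norm_num [vv]) fun j hj hji => ?_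
    have hle : ∀ n : ℕ, x ^ n ≤ (1 / 9) ^ n := fun n => pow_le_pow_left₀ hx h.le n
    have : j < 9 := by simpa using hj
    interval_cases j
    · exact absurd rfl hji
    · norm_num [vv]; linarith
    all_goals
      norm_num [vv]
    · nlinarith [hle 2]
    · have : x ^ 3 < (1 / 9) ^ 3 := pow_lt_pow_left₀ h hx (by norm_num)
      norm_num at this; linarith
    · have : x ^ 4 < (1 / 9) ^ 4 := pow_lt_pow_left₀ h hx (by norm_num)
      norm_num at this; linarith
    · have := hle 5; norm_num at this; linarith
    · have := hle 6; norm_num at this; linarith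
    · have := hle 7; norm_num at this; linarith
    · have := hle 8; norm_num at this; linarith
  have hx0 : 0 < x := by linarith
  rcases lt_or_gt_of_ne c3 with h1 | h1
  · rcases lt_or_gt_of_ne c2 with h2 | h2
    · -- the quartic term dominates
      refine key 4 (by simp) (by norm_num [vv]; positivity) fun j hj hji => ?_
      have : j < 9 := by simpa using hj
      have h4 : 0 < x ^ 4 := by positivity
      have p2 : (1 / 9) ^ 2 < x ^ 2 := pow_lt_pow_left₀ h (by norm_num) (by norm_num)
      have p3 : (1 / 9) ^ 3 < x ^ 3 := pow_lt_pow_left₀ h (by norm_num) (by norm_num)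
      have p4 : (1 / 9) ^ 4 < x ^ 4 := pow_lt_pow_left₀ h (by norm_num) (by norm_num)
      have e5 : x ^ 5 = x ^ 4 * x := by ring
      have e6 : x ^ 6 = x ^ 4 * x ^ 2 := by ring
      have e7 : x ^ 7 = x ^ 4 * x ^ 3 := by ring
      have e8 : x ^ 8 = x ^ 4 * x ^ 3 * x := by ring
      have q2 : x ^ 2 < 1 := by nlinarith
      interval_cases j <;> norm_num [vv] at p2 p3 p4 ⊢
      · linarith
      · have : x ^ 4 = x * x ^ 3 := by ring
        nlinarith
      · have : x ^ 4 = x ^ 2 * x ^ 2 := by ring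
        nlinarith
      · have : x ^ 4 = x ^ 3 * x := by ring
        nlinarith
      · exact absurd rfl hji
      · nlinarith
      · nlinarith
      · nlinarith
      · have : x ^ 3 * x < 1 / 3 := by nlinarith
        nlinarith
    · -- the seventh-degree term dominates
      refine key 7 (by simp) (by norm_num [vv]; positivity) fun j hj hji => ?_
      have : j < 9 := by simpa using hj
      have q2 : 1 / 3 < x ^ 2 := by nlinarith
      have q1 : 1 / 3 < x := by nlinarith
      have q4 : 1 / 9 < x ^ 4 := by nlinarith
      have q5 : 1 / 9 < x ^ 5 := by nlinarith [mul_pos (sub_pos.2 q2) (sub_pos.2 h2)]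
      have q6 : 1 / 9 < x ^ 6 := by nlinarith
      have q7 : 1 / 27 < x ^ 7 := by nlinarith
      interval_cases j <;> norm_num [vv]
      · linarith
      · have : x ^ 7 = x * x ^ 6 := by ring
        nlinarith
      · have : x ^ 7 = x ^ 2 * x ^ 5 := by ring
        nlinarith
      · have : x ^ 7 = x ^ 3 * x ^ 4 := by ring
        nlinarith
      · have : x ^ 7 = x ^ 4 * x ^ 3 := by ring
        nlinarith
      · have : x ^ 7 = x ^ 5 * x ^ 2 := by ring
        nlinarith
      · have : x ^ 7 = x ^ 6 * x := by ring
        nlinarith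
      · exact absurd rfl hji
      · have : x ^ 8 = x ^ 7 * x := by ring
        nlinarith
  · refine key 8 (by simp) (by norm_num [vv]; positivity) fun j hj hji => ?_
    have : j < 9 := by simpa using hj
    have h8 : x ^ j < x ^ 8 := pow_lt_pow_right₀ h1 (by omega)
    have : 0 < x ^ j := by positivity
    have hv : ((1 : ℝ) / 3) ^ vv j ≤ 1 := pow_le_one₀ (by norm_num) (by norm_num)
    calc ((1 : ℝ) / 3) ^ vv j * x ^ j ≤ 1 * x ^ j := by gcongr
      _ < _ := by simpa [vv] using h8

/-- Multiset counting: the product of three-valued elements. -/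
lemma count_prod (s : Multiset ℝ) (h : ∀ x ∈ s, x = 1 / 9 ∨ x ^ 3 = 1 / 3 ∨ x = 1) :
    ∃ a : ℕ, a + s.countP (fun x => x ^ 3 = 1 / 3) + s.countP (fun x => x = 1) = s.card ∧
      s.prod ^ 3 = (1 / 3) ^ (6 * a + s.countP (fun x => x ^ 3 = 1 / 3)) := by
  induction s using Multiset.induction_on with
  | empty => exact ⟨0, by simp⟩
  | cons x s ih =>
    obtain ⟨a, h1, h2⟩ := ih fun y hy => h y (by simp [hy])
    simp only [Multiset.countP_cons, Multiset.prod_cons, Multiset.card_cons, mul_pow, h2]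
    rcases h x (by simp) with hx | hx | hx
    · have n1 : ¬ x ^ 3 = 1 / 3 := by rw [hx]; norm_num
      have n2 : ¬ x = 1 := by rw [hx]; norm_num
      refine ⟨a + 1, ?_, ?_⟩
      · rw [if_neg n1, if_neg n2]; omega
      · rw [if_neg n1, hx]; ring
    · have n2 : ¬ x = 1 := by rintro rfl; norm_num at hx
      refine ⟨a, ?_, ?_⟩
      · rw [if_pos hx, if_neg n2]; omega
      · rw [if_pos hx, hx]; ring
    · have n1 : ¬ x ^ 3 = 1 / 3 := by rw [hx]; norm_num
      refine ⟨a, ?_, ?_⟩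
      · rw [if_neg n1, if_pos hx]; omega
      · rw [if_neg n1, hx]; ring

lemma smul_coe (r : gTilde3.rootSet gTilde3.SplittingField) (σ : gTilde3.Gal) :
    ((σ • r : gTilde3.rootSet gTilde3.SplittingField) : gTilde3.SplittingField) = σ r := by
  rfl


lemma pow_right_injective_of_third {m n : ℕ} (h : ((1 : ℝ) / 3) ^ m = (1 / 3) ^ n) : m = n :=
  pow_right_injective₀ (by norm_num) (by norm_num) h

/-- The extension of the 3-adic absolute value to the splitting field. -/
lemma exists_norm : ∃ N : gTilde3.SplittingField → ℝ, N 0 = 0 ∧ N 1 = 1 ∧ (∀ x, 0 ≤ N x) ∧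
    (∀ x, N (-x) = N x) ∧ (∀ x y, N (x * y) = N x * N y) ∧
    (∀ x : ℚ_[3], N (algebraMap ℚ_[3] gTilde3.SplittingField x) = ‖x‖) ∧
    (∀ x y, N (x + y) ≤ max (N x) (N y)) ∧
    (∀ (σ : gTilde3.Gal) x, N (σ x) = N x) := by
  have : Algebra.IsAlgebraic ℚ_[3] gTilde3.SplittingField := inferInstance
  refine ⟨spectralNorm ℚ_[3] gTilde3.SplittingField, spectralNorm_zero, spectralNorm_one,
    spectralNorm_nonneg,
    fun x => spectralNorm_neg (Algebra.IsAlgebraic.isAlgebraic x), fun x y => ?_,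
    fun x => spectralNorm_extends x, isNonarchimedean_spectralNorm,
    fun σ x => (spectralNorm_eq_of_equiv σ x).symm⟩
  exact map_mul (spectralMulAlgNorm ℚ_[3] gTilde3.SplittingField) x y

lemma counts (N : gTilde3.SplittingField → ℝ) (h0 : N 0 = 0) (hone : N 1 = 1)
    (hnn : ∀ x, 0 ≤ N x) (hneg : ∀ x, N (-x) = N x) (hmul : ∀ x y, N (x * y) = N x * N y)
    (hext : ∀ x : ℚ_[3], N (algebraMap ℚ_[3] gTilde3.SplittingField x) = ‖x‖)
    (hadd : ∀ x y, N (x + y) ≤ max (N x) (N y)) :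
    ((gTilde3.aroots gTilde3.SplittingField).filter (fun x => N x ^ 3 = 1 / 3)).card = 3 ∧
    ((gTilde3.aroots gTilde3.SplittingField).filter (fun x => N x = 1)).card = 1 := by
  have hpow : ∀ x (n : ℕ), N (x ^ n) = N x ^ n := by
    intro x n
    induction n with
    | zero => simpa using hone
    | succ n ih => rw [pow_succ, pow_succ, hmul, ih]
  have hsp := SplittingField.splits gTilde3
  have hcard : (gTilde3.aroots gTilde3.SplittingField).card = 8 := by
    rw [aroots, ← hsp.natDegree_eq_card_roots, natDegree_map, g3_natDegree]
  have hprod := hsp.coeff_zero_eq_prod_roots_of_monic (g3_monic.map _)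
  have hNprod : N (gTilde3.aroots gTilde3.SplittingField).prod =
      ((gTilde3.aroots gTilde3.SplittingField).map N).prod := by
    let φ : gTilde3.SplittingField →* ℝ := ⟨⟨N, hone⟩, hmul⟩
    exact map_multiset_prod φ _
  have hval : N (gTilde3.aroots gTilde3.SplittingField).prod = (1 / 3) ^ 9 := by
    have h := congrArg N hprod
    rw [coeff_map, hext, g3_coeff 0 (by norm_num), hmul, hpow, hneg, hone, one_pow, one_mul] at h
    exact h.symm
  obtain ⟨a, h1, h2⟩ := count_prod ((gTilde3.aroots gTilde3.SplittingField).map N) (by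
    intro x hx
    obtain ⟨r, hr, rfl⟩ := Multiset.mem_map.1 hx
    exact root_norm N h0 hnn hneg hmul hpow hext hadd r (mem_aroots'.1 hr).2)
  rw [← hNprod, hval, ← pow_mul] at h2
  have h3 := pow_right_injective_of_third h2
  rw [Multiset.card_map, hcard] at h1
  rw [Multiset.countP_map] at h1 h3
  rw [Multiset.countP_map] at h1
  constructor <;> omega

lemma main_fixed : ∃ r : gTilde3.rootSet gTilde3.SplittingField, ∀ σ : gTilde3.Gal, σ • r = r := by
  obtain ⟨N, h0, hone, hnn, hneg, hmul, hext, hadd, hinv⟩ := exists_norm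
  obtain ⟨-, hc⟩ := counts N h0 hone hnn hneg hmul hext hadd
  obtain ⟨r, hr⟩ := Multiset.card_eq_one.1 hc
  have key : ∀ x, x ∈ gTilde3.rootSet gTilde3.SplittingField → N x = 1 → x = r := by
    intro x hx hN
    have : x ∈ (gTilde3.aroots gTilde3.SplittingField).filter (fun x => N x = 1) := by
      rw [Multiset.mem_filter]
      exact ⟨by simpa [rootSet] using hx, hN⟩
    rw [hr] at this
    simpa using this
  have hmem : r ∈ (gTilde3.aroots gTilde3.SplittingField).filter (fun x => N x = 1) := by
    rw [hr]; simp
  rw [Multiset.mem_filter] at hmem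
  refine ⟨⟨r, by simpa [rootSet] using hmem.1⟩, fun σ => Subtype.ext ?_⟩
  refine key _ (Subtype.mem _) ?_
  rw [smul_coe, hinv]
  exact hmem.2

lemma main_orbit : ∃ r : gTilde3.rootSet gTilde3.SplittingField,
      Nat.card (MulAction.orbit gTilde3.Gal r) = 3 := by
  classical
  obtain ⟨N, h0, hone, hnn, hneg, hmul, hext, hadd, hinv⟩ := exists_norm
  obtain ⟨hc, -⟩ := counts N h0 hone hnn hneg hmul hext hadd
  obtain ⟨r, hr⟩ := Multiset.card_pos_iff_exists_mem.1 (by rw [hc]; norm_num :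
    0 < ((gTilde3.aroots gTilde3.SplittingField).filter (fun x => N x ^ 3 = 1 / 3)).card)
  have hr' := Multiset.mem_filter.1 hr
  let r' : gTilde3.rootSet gTilde3.SplittingField := ⟨r, by simpa [rootSet] using hr'.1⟩
  refine ⟨r', ?_⟩
  have hfin : (MulAction.orbit gTilde3.Gal r').Finite := Set.toFinite _
  let O : Finset (gTilde3.rootSet gTilde3.SplittingField) := hfin.toFinset
  have hO : Nat.card (MulAction.orbit gTilde3.Gal r') = O.card :=
    Nat.card_eq_card_finite_toFinset hfin
  have hON : ∀ s ∈ O, N s ^ 3 = 1 / 3 := by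
    intro s hs
    obtain ⟨σ, rfl⟩ := hfin.mem_toFinset.1 hs
    change N ((σ • r' : gTilde3.rootSet gTilde3.SplittingField) : gTilde3.SplittingField) ^ 3 = _
    rw [smul_coe, hinv]
    exact hr'.2
  have hle : O.card ≤ 3 := by
    rw [← Finset.card_image_of_injective O Subtype.val_injective]
    refine (Finset.card_le_card ?_).trans ((Multiset.toFinset_card_le _).trans hc.le)
    intro x hx
    obtain ⟨s, hs, rfl⟩ := Finset.mem_image.1 hx
    rw [Multiset.mem_toFinset, Multiset.mem_filter]
    exact ⟨by simpa [rootSet] using s.2, hON s hs⟩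
  have hpos : 0 < O.card :=
    Finset.card_pos.2 ⟨r', hfin.mem_toFinset.2 (MulAction.mem_orbit_self r')⟩
  let P : gTilde3.SplittingField := ∏ s ∈ O, (s : gTilde3.SplittingField)
  have hPfix : ∀ σ : gTilde3.Gal, σ P = P := by
    intro σ
    rw [show σ P = ∏ s ∈ O, σ (s : gTilde3.SplittingField) from map_prod σ _ _]
    refine Finset.prod_bij (fun s _ => σ • s) ?_ ?_ ?_ ?_
    · intro s hs
      rw [hfin.mem_toFinset] at hs ⊢
      exact MulAction.mem_orbit_of_mem_orbit _ hs
    · intro a _ b _ h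
      exact MulAction.injective σ h
    · intro b hb
      refine ⟨σ⁻¹ • b, ?_, smul_inv_smul σ b⟩
      rw [hfin.mem_toFinset] at hb ⊢
      exact MulAction.mem_orbit_of_mem_orbit _ hb
    · intro a _
      rfl
  have : IsGalois ℚ_[3] gTilde3.SplittingField := {}
  obtain ⟨q, hq⟩ := (IsGalois.mem_range_algebraMap_iff_fixed P).2 hPfix
  have hNP : N P ^ 3 = (1 / 3) ^ O.card := by
    let φ : gTilde3.SplittingField →* ℝ := ⟨⟨N, hone⟩, hmul⟩
    have : N P = ∏ s ∈ O, N (s : gTilde3.SplittingField) := map_prod φ _ _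
    rw [this, ← Finset.prod_pow, Finset.prod_congr rfl hON, Finset.prod_const]
  rw [← hq, hext] at hNP
  have hq0 : q ≠ 0 := by
    rintro rfl
    rw [norm_zero] at hNP
    have : (0 : ℝ) < (1 / 3) ^ O.card := by positivity
    rw [← hNP] at this
    norm_num at this
  rw [Padic.norm_eq_zpow_neg_valuation hq0, ← zpow_natCast, ← zpow_mul, one_div, inv_pow,
    ← zpow_natCast, ← zpow_neg] at hNP
  have h3 := zpow_right_injective₀ (by norm_num) (by norm_num) hNP
  rw [hO]
  push_cast at h3
  omega

/-- The Newton polygon of `g̃` at the prime `3` — the lower convex hull of the points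
`(j, v₃(coeff j))`, `0 ≤ j ≤ 8` — consists of three segments of horizontal lengths `4`,
`3`, `1` with slopes `−2`, `−1/3`, `0`: all points lie on or above the piecewise linear
function `lowerNP`, with equality (vertices/endpoints) at `j = 0, 4, 7, 8`, where the
values are `9, 1, 0, 0`. Consequently, the decomposition group at `3` of the splitting
field of `g̃` over `ℚ`, as a permutation group on the 8 roots, has at least one fixed
point and at least one orbit of length `3`. -/
theorem newton_polygon_of_gTilde_at_three :
    ((∀ j ≤ 8, gTilde.coeff j ≠ 0 ∧ lowerNP j ≤ npPoint j) ∧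
      npPoint 0 = 9 ∧ npPoint 4 = 1 ∧ npPoint 7 = 0 ∧ npPoint 8 = 0) ∧
    (∃ r : gTilde3.rootSet gTilde3.SplittingField, ∀ σ : gTilde3.Gal, σ • r = r) ∧
    (∃ r : gTilde3.rootSet gTilde3.SplittingField,
      Nat.card (MulAction.orbit gTilde3.Gal r) = 3) := by
  exact ⟨np_part, main_fixed, main_orbit⟩
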